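/- Continuous strong maximum principle: Suppose Ω is in addition connected. Let c : ℝᵈ → ℝ be twice continuously differentiable on Ω, continuous on cl(Ω), with L[c](x) ≤ 0 for all x ∈ Ω. If c attains a non-negative maximum at an interior point, i.e., there exists x₀ ∈ Ω with c(x₀) = max_{x ∈ cl(Ω)} c(x) and c(x₀) ≥ 0, then c is constant on cl(Ω): c(x) = c(x₀) for all x ∈ cl(Ω). -/

import Mathlib

noncomputable section

/-- Partial derivative in the `i`-th coordinate direction. -/
def pd (d : ℕ) (f : EuclideanSpace ℝ (Fin d) → ℝ) (i : Fin d)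
    (x : EuclideanSpace ℝ (Fin d)) : ℝ :=
  fderiv ℝ f x (EuclideanSpace.single i 1)

/-- The elliptic operator in divergence form
`L[c](x) = −div(D(x)·grad c(x)) + v(x)·grad c(x) + α(x) c(x)`. -/
def Lop (d : ℕ) (D : EuclideanSpace ℝ (Fin d) → Matrix (Fin d) (Fin d) ℝ)
    (v : EuclideanSpace ℝ (Fin d) → EuclideanSpace ℝ (Fin d))
    (α : EuclideanSpace ℝ (Fin d) → ℝ)
    (c : EuclideanSpace ℝ (Fin d) → ℝ) (x : EuclideanSpace ℝ (Fin d)) : ℝ :=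
  -(∑ i, pd d (fun y => ∑ j, D y i j * pd d c j y) i x)
    + (∑ i, v x i * pd d c i x) + α x * c x

section
open Filter Topology

/-- Partial derivatives of a `C²` function are `C¹`. -/
lemma contDiffAt_pd {d : ℕ} {f : EuclideanSpace ℝ (Fin d) → ℝ} {x : EuclideanSpace ℝ (Fin d)}
    (hf : ContDiffAt ℝ 2 f x) (i : Fin d) : ContDiffAt ℝ 1 (pd d f i) x :=
  (hf.fderiv_right (m := 1) (by norm_num)).clm_apply contDiffAt_const

/-- Expansion of one component of the divergence of the flux. -/
lemma pd_flux {d : ℕ} {D : EuclideanSpace ℝ (Fin d) → Matrix (Fin d) (Fin d) ℝ}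
    (hD : ∀ i j, ContDiff ℝ 1 (fun x => D x i j))
    {f : EuclideanSpace ℝ (Fin d) → ℝ} {x : EuclideanSpace ℝ (Fin d)}
    (hf : ContDiffAt ℝ 2 f x) (i : Fin d) :
    pd d (fun y => ∑ j, D y i j * pd d f j y) i x =
      ∑ j, (D x i j * pd d (pd d f j) i x + pd d f j x * pd d (fun y => D y i j) i x) := by
  have h1 : ∀ j, DifferentiableAt ℝ (fun y => D y i j) x := fun j =>
    ((hD i j).differentiable (by norm_num)).differentiableAt
  have h2 : ∀ j, DifferentiableAt ℝ (pd d f j) x := fun j =>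
    (contDiffAt_pd hf j).differentiableAt (by norm_num)
  rw [pd, fderiv_fun_sum (fun j _ => (h1 j).fun_mul (h2 j)), sum_apply]
  refine Finset.sum_congr rfl fun j _ => ?_
  rw [fderiv_fun_mul (h1 j) (h2 j)]
  simp [pd]

lemma pd_add_const_mul {d : ℕ} {f g : EuclideanSpace ℝ (Fin d) → ℝ}
    {x : EuclideanSpace ℝ (Fin d)} (hf : DifferentiableAt ℝ f x) (hg : DifferentiableAt ℝ g x)
    (ε : ℝ) (i : Fin d) : pd d (fun y => f y + ε * g y) i x = pd d f i x + ε * pd d g i x := by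
  simp only [pd]
  rw [fderiv_fun_add hf (hg.const_mul ε), fderiv_const_mul hg]
  simp

lemma pd_pd_add_const_mul {d : ℕ} {f g : EuclideanSpace ℝ (Fin d) → ℝ}
    {x : EuclideanSpace ℝ (Fin d)} (hf : ContDiffAt ℝ 2 f x) (hg : ContDiffAt ℝ 2 g x)
    (ε : ℝ) (i j : Fin d) : pd d (pd d (fun y => f y + ε * g y) j) i x =
      pd d (pd d f j) i x + ε * pd d (pd d g j) i x := by
  have h : pd d (fun y => f y + ε * g y) j =ᶠ[𝓝 x] fun y => pd d f j y + ε * pd d g j y := by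
    filter_upwards [hf.eventually (by norm_num), hg.eventually (by norm_num)] with y h1 h2
    exact pd_add_const_mul (h1.differentiableAt (by norm_num))
      (h2.differentiableAt (by norm_num)) ε j
  rw [pd, h.fderiv_eq]
  exact pd_add_const_mul ((contDiffAt_pd hf j).differentiableAt (by norm_num))
    ((contDiffAt_pd hg j).differentiableAt (by norm_num)) ε i

lemma Lop_add_const_mul {d : ℕ} {D : EuclideanSpace ℝ (Fin d) → Matrix (Fin d) (Fin d) ℝ}
    (hD : ∀ i j, ContDiff ℝ 1 (fun x => D x i j))
    (v : EuclideanSpace ℝ (Fin d) → EuclideanSpace ℝ (Fin d))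
    (α : EuclideanSpace ℝ (Fin d) → ℝ) {f g : EuclideanSpace ℝ (Fin d) → ℝ}
    {x : EuclideanSpace ℝ (Fin d)} (hf : ContDiffAt ℝ 2 f x) (hg : ContDiffAt ℝ 2 g x) (ε : ℝ) :
    Lop d D v α (fun y => f y + ε * g y) x = Lop d D v α f x + ε * Lop d D v α g x := by
  have hfg : ContDiffAt ℝ 2 (fun y => f y + ε * g y) x := hf.add (contDiffAt_const.mul hg)
  have h1 := hf.differentiableAt (n := 2) (by norm_num)
  have h2 := hg.differentiableAt (n := 2) (by norm_num)
  simp only [Lop, pd_flux hD hfg, pd_flux hD hf, pd_flux hD hg, pd_add_const_mul h1 h2,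
    pd_pd_add_const_mul hf hg, mul_add, add_mul, Finset.sum_add_distrib, mul_neg, Finset.mul_sum]
  simp only [mul_left_comm, mul_assoc]
  ring

/-- `L[f]` is continuous wherever `v` and `α` are, for `f` of class `C²`. -/
lemma continuousAt_Lop {d : ℕ} {D : EuclideanSpace ℝ (Fin d) → Matrix (Fin d) (Fin d) ℝ}
    (hD : ∀ i j, ContDiff ℝ 1 (fun x => D x i j))
    {v : EuclideanSpace ℝ (Fin d) → EuclideanSpace ℝ (Fin d)}
    {α f : EuclideanSpace ℝ (Fin d) → ℝ} {x : EuclideanSpace ℝ (Fin d)}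
    (hv : ContinuousAt v x) (hα : ContinuousAt α x) (hf : ContDiffAt ℝ 2 f x) :
    ContinuousAt (Lop d D v α f) x := by
  have hpd : ∀ j, ContDiffAt ℝ 1 (pd d f j) x := contDiffAt_pd hf
  have hflux : ∀ i, ContDiffAt ℝ 1 (fun y => ∑ j, D y i j * pd d f j y) x := fun i =>
    ContDiffAt.sum fun j _ => (hD i j).contDiffAt.mul (hpd j)
  have hdiv : ∀ i, ContinuousAt (pd d (fun y => ∑ j, D y i j * pd d f j y) i) x := fun i =>
    (((hflux i).fderiv_right (m := 0) (by norm_num)).clm_apply contDiffAt_const).continuousAt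
  have hvi : ∀ i, ContinuousAt (fun y => v y i) x := fun i =>
    (EuclideanSpace.proj (𝕜 := ℝ) i).continuous.continuousAt.comp hv
  refine ContinuousAt.add (ContinuousAt.add (ContinuousAt.neg ?_) ?_) (hα.mul hf.continuousAt)
  · exact tendsto_finsetSum _ fun i _ => hdiv i
  · exact tendsto_finsetSum _ fun i _ => (hvi i).mul (hpd i).continuousAt

/-- Adding `K φ²` to a function `φ` vanishing at `x` lowers `L[φ](x)` by `2K ∇φ·D∇φ`. -/
lemma Lop_add_const_mul_sq {d : ℕ} {D : EuclideanSpace ℝ (Fin d) → Matrix (Fin d) (Fin d) ℝ}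
    (hD : ∀ i j, ContDiff ℝ 1 (fun x => D x i j))
    (v : EuclideanSpace ℝ (Fin d) → EuclideanSpace ℝ (Fin d))
    (α : EuclideanSpace ℝ (Fin d) → ℝ) {φ : EuclideanSpace ℝ (Fin d) → ℝ}
    {x : EuclideanSpace ℝ (Fin d)} (hφ : ContDiff ℝ 2 φ) (hx : φ x = 0) (K : ℝ) :
    Lop d D v α (fun y => φ y + K * φ y ^ 2) x =
      Lop d D v α φ x - 2 * K * ∑ i, ∑ j, pd d φ i x * D x i j * pd d φ j x := by
  have hsq : ContDiff ℝ 2 (fun y => φ y ^ 2) := hφ.pow 2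
  have hd : Differentiable ℝ φ := hφ.differentiable (by norm_num)
  have h1 : ∀ j, pd d (fun y => φ y ^ 2) j = fun y => 2 * φ y * pd d φ j y := by
    intro j
    funext y
    simp only [pd]
    rw [fderiv_fun_pow 2 (hd y)]
    simp
  have h2 : ∀ i j, pd d (pd d (fun y => φ y ^ 2) j) i x = 2 * pd d φ i x * pd d φ j x := by
    intro i j
    rw [h1, pd, fderiv_fun_mul ((hd x).const_mul 2)
      ((contDiffAt_pd hφ.contDiffAt j).differentiableAt (by norm_num)), fderiv_const_mul (hd x)]
    simp [hx, pd]
    ring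
  rw [Lop_add_const_mul hD v α hφ.contDiffAt hsq.contDiffAt]
  have h3 : Lop d D v α (fun y => φ y ^ 2) x =
      -2 * ∑ i, ∑ j, pd d φ i x * D x i j * pd d φ j x := by
    rw [Lop]
    simp only [pd_flux hD hsq.contDiffAt, h2]
    simp only [h1, hx, Finset.mul_sum, mul_zero, zero_mul, add_zero, Finset.sum_const_zero,
      ← Finset.sum_neg_distrib, ne_eq, OfNat.ofNat_ne_zero, not_false_eq_true, zero_pow]
    refine Finset.sum_congr rfl fun i _ => Finset.sum_congr rfl fun j _ => ?_
    ring
  rw [h3]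
  ring

/-- The Hessian is negative semidefinite at a local maximum. -/
lemma IsLocalMax.sum_pd_pd_nonpos {d : ℕ} {u : EuclideanSpace ℝ (Fin d) → ℝ}
    {x : EuclideanSpace ℝ (Fin d)} (hu : ContDiffAt ℝ 2 u x) (hmax : IsLocalMax u x)
    (ξ : Fin d → ℝ) : ∑ i, ∑ j, ξ i * ξ j * pd d (pd d u j) i x ≤ 0 := by
  set e : EuclideanSpace ℝ (Fin d) := ∑ i, ξ i • EuclideanSpace.single i (1 : ℝ) with he
  have hline : ∀ t : ℝ, HasDerivAt (fun t : ℝ => x + t • e) e t := fun t => by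
    simpa using ((hasDerivAt_id t).smul_const e).const_add x
  have hline0 : Tendsto (fun t : ℝ => x + t • e) (𝓝 0) (𝓝 x) := by
    simpa using (hline 0).continuousAt.tendsto
  have hex : ∀ f : EuclideanSpace ℝ (Fin d) → ℝ, ∀ y, fderiv ℝ f y e = ∑ i, ξ i * pd d f i y := by
    intro f y
    simp [he, pd]
  have hg1 : ∀ᶠ t in 𝓝 (0 : ℝ), HasDerivAt (fun t : ℝ => u (x + t • e))
      (∑ j, ξ j * pd d u j (x + t • e)) t := by
    filter_upwards [hline0.eventually (hu.eventually (by norm_num))] with t ht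
    rw [← hex]
    exact (ht.differentiableAt (by norm_num)).hasFDerivAt.comp_hasDerivAt t (hline t)
  have hpd : ∀ j, DifferentiableAt ℝ (pd d u j) x := fun j =>
    (contDiffAt_pd hu j).differentiableAt (by norm_num)
  have hg2 : HasDerivAt (fun t : ℝ => ∑ j, ξ j * pd d u j (x + t • e))
      (∑ j, ξ j * ∑ i, ξ i * pd d (pd d u j) i x) 0 := by
    refine HasDerivAt.fun_sum fun j _ => HasDerivAt.const_mul _ ?_
    rw [← hex]
    have := (hpd j).hasFDerivAt
    rw [show x = x + (0 : ℝ) • e by simp] at this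
    simpa [Function.comp_def] using this.comp_hasDerivAt (0 : ℝ) (hline 0)
  have hderiv : deriv (fun t : ℝ => u (x + t • e)) =ᶠ[𝓝 0]
      fun t : ℝ => ∑ j, ξ j * pd d u j (x + t • e) := hg1.mono fun t ht => ht.deriv
  have hval : deriv (deriv (fun t : ℝ => u (x + t • e))) 0 =
      ∑ i, ∑ j, ξ i * ξ j * pd d (pd d u j) i x := by
    rw [hderiv.deriv_eq, hg2.deriv, Finset.sum_comm]
    simp only [Finset.mul_sum]
    refine Finset.sum_congr rfl fun i _ => Finset.sum_congr rfl fun j _ => ?_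
    ring
  have hgmax : IsLocalMax (fun t : ℝ => u (x + t • e)) 0 := by
    have := hline0.eventually hmax
    filter_upwards [this] with t ht
    simpa using ht
  by_contra! hpos
  have hgmin := isLocalMin_of_deriv_deriv_pos (hval ▸ hpos) hgmax.deriv_eq_zero
    hg1.self_of_nhds.continuousAt
  have hconst : (fun t : ℝ => u (x + t • e)) =ᶠ[𝓝 0] fun _ => u (x + (0 : ℝ) • e) := by
    filter_upwards [hgmax, hgmin] with t h1 h2 using le_antisymm h1 h2
  have : deriv (deriv (fun t : ℝ => u (x + t • e))) 0 = 0 := by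
    rw [hconst.deriv.deriv_eq]
    simp
  linarith [hval]

open scoped MatrixOrder Matrix.Norms.L2Operator in
/-- `L[u] ≥ 0` at a local maximum with nonnegative value. -/
lemma IsLocalMax.Lop_nonneg {d : ℕ} {D : EuclideanSpace ℝ (Fin d) → Matrix (Fin d) (Fin d) ℝ}
    (hD : ∀ i j, ContDiff ℝ 1 (fun x => D x i j))
    (v : EuclideanSpace ℝ (Fin d) → EuclideanSpace ℝ (Fin d))
    {α u : EuclideanSpace ℝ (Fin d) → ℝ} {x : EuclideanSpace ℝ (Fin d)}
    (hmax : IsLocalMax u x) (hu : ContDiffAt ℝ 2 u x) (hDx : (D x).PosSemidef)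
    (hα : 0 ≤ α x) (hux : 0 ≤ u x) : 0 ≤ Lop d D v α u x := by
  have hpd : ∀ i, pd d u i x = 0 := fun i => by simp [pd, hmax.fderiv_eq_zero]
  obtain ⟨B, hB⟩ : ∃ B : Matrix (Fin d) (Fin d) ℝ, D x = B.conjTranspose * B :=
    CStarAlgebra.nonneg_iff_eq_star_mul_self.mp hDx.nonneg
  have key : ∑ i, ∑ j, D x i j * pd d (pd d u j) i x =
      ∑ k, ∑ i, ∑ j, B k i * B k j * pd d (pd d u j) i x := by
    rw [Finset.sum_comm]
    conv_rhs => rw [Finset.sum_comm]; enter [2, i]; rw [Finset.sum_comm]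
    rw [Finset.sum_comm]
    simp only [hB, Matrix.mul_apply, Matrix.conjTranspose_apply, star_trivial, Finset.sum_mul]
  have hle : ∑ i, ∑ j, D x i j * pd d (pd d u j) i x ≤ 0 := by
    rw [key]
    exact Finset.sum_nonpos fun k _ => IsLocalMax.sum_pd_pd_nonpos hu hmax (B k)
  have h0 := mul_nonneg hα hux
  simp only [Lop, pd_flux hD hu, hpd, zero_mul, mul_zero, add_zero, Finset.sum_const_zero]
  linarith

/-- The touching argument of Hopf: a nonnegative value of a subsolution `c` at `p` cannot be strictly
larger than all other values of `c` on a set `{φ ≥ 0}` whose boundary passes through `p` with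
nonzero gradient. -/
lemma false_of_lt_on_superlevel {d : ℕ} {Ω : Set (EuclideanSpace ℝ (Fin d))} (hΩ : IsOpen Ω)
    {D : EuclideanSpace ℝ (Fin d) → Matrix (Fin d) (Fin d) ℝ}
    (hD : ∀ i j, ContDiff ℝ 1 (fun x => D x i j)) (hDpos : ∀ x ∈ Ω, (D x).PosSemidef)
    {v : EuclideanSpace ℝ (Fin d) → EuclideanSpace ℝ (Fin d)} (hv : ContinuousOn v Ω)
    {α : EuclideanSpace ℝ (Fin d) → ℝ} (hα : Continuous α) (hαnn : ∀ x ∈ Ω, 0 ≤ α x)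
    {c : EuclideanSpace ℝ (Fin d) → ℝ} (hc : ContDiffOn ℝ 2 c Ω)
    (hLc : ∀ x ∈ Ω, Lop d D v α c x ≤ 0)
    {p : EuclideanSpace ℝ (Fin d)} (hp : p ∈ Ω) (hcp : 0 ≤ c p)
    (hmax : ∀ x ∈ Ω, c x ≤ c p)
    {φ : EuclideanSpace ℝ (Fin d) → ℝ} (hφ : ContDiff ℝ 2 φ) (hφp : φ p = 0)
    (hgrad : 0 < ∑ i, ∑ j, pd d φ i p * D p i j * pd d φ j p)
    (hlt : ∀ x ∈ Ω, 0 ≤ φ x → x ≠ p → c x < c p) : False := by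
  set S := ∑ i, ∑ j, pd d φ i p * D p i j * pd d φ j p
  obtain ⟨K, hK⟩ : ∃ K : ℝ, Lop d D v α φ p - 2 * K * S < 0 :=
    ⟨(Lop d D v α φ p + 1) / (2 * S), by field_simp; linarith⟩
  set w : EuclideanSpace ℝ (Fin d) → ℝ := fun y => φ y + K * φ y ^ 2 with hw
  have hwC : ContDiff ℝ 2 w := hφ.add (contDiff_const.mul (hφ.pow 2))
  have hLw : Lop d D v α w p < 0 := by
    rwa [hw, Lop_add_const_mul_sq hD v α hφ hφp]
  have hφc : Continuous φ := hφ.continuous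
  have hev : ∀ᶠ x in 𝓝 p, x ∈ Ω ∧ Lop d D v α w x < 0 ∧ 0 < 1 + K * φ x := by
    refine (hΩ.eventually_mem hp).and (Eventually.and ?_ ?_)
    · exact (continuousAt_Lop hD (hv.continuousAt (hΩ.mem_nhds hp)) hα.continuousAt
        hwC.contDiffAt).eventually_lt_const hLw
    · have : ContinuousAt (fun x => 1 + K * φ x) p := by fun_prop
      exact this.eventually_const_lt (by simp [hφp])
  obtain ⟨ρ, hρ, hball⟩ := Metric.nhds_basis_closedBall.eventually_iff.mp hev
  have hcb : ContinuousOn c (Metric.closedBall p ρ) :=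
    hc.continuousOn.mono fun x hx => (hball hx).1
  have hT : IsCompact (Metric.sphere p ρ ∩ {x | 0 ≤ φ x}) :=
    (isCompact_sphere p ρ).inter_right (isClosed_le continuous_const hφc)
  have hTlt : ∀ x ∈ Metric.sphere p ρ ∩ {x | 0 ≤ φ x}, c x < c p := fun x hx =>
    hlt x (hball (Metric.sphere_subset_closedBall hx.1)).1 hx.2
      (Metric.ne_of_mem_sphere hx.1 hρ.ne')
  obtain ⟨B, hB⟩ := hT.exists_bound_of_continuousOn (f := fun x => w x / (c p - c x))
    (hwC.continuous.continuousOn.div (continuousOn_const.sub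
      (hcb.mono (Set.inter_subset_left.trans Metric.sphere_subset_closedBall)))
      fun x hx => (sub_pos.mpr (hTlt x hx)).ne')
  obtain ⟨ε, hε, hεB⟩ : ∃ ε : ℝ, 0 < ε ∧ ε * B < 1 :=
    ⟨1 / (|B| + 1), by positivity, by
      rw [one_div_mul_eq_div, div_lt_one (by positivity)]
      linarith [le_abs_self B]⟩
  have hsphere : ∀ x ∈ Metric.sphere p ρ, c x + ε * w x < c p := by
    intro x hx
    obtain ⟨hxΩ, -, hxK⟩ := hball (Metric.sphere_subset_closedBall hx)
    rcases lt_or_ge (φ x) 0 with h | h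
    · have hwx : w x < 0 := by
        have := mul_neg_of_neg_of_pos h hxK
        simp only [hw]
        linarith
      linarith [hmax x hxΩ, mul_neg_of_pos_of_neg hε hwx]
    · have hpos := sub_pos.mpr (hTlt x ⟨hx, h⟩)
      have h1 := (div_le_iff₀ hpos).mp ((le_abs_self _).trans (hB x ⟨hx, h⟩))
      have h2 := mul_le_mul_of_nonneg_left h1 hε.le
      have h3 := mul_lt_mul_of_pos_right hεB hpos
      linarith
  have hu : ContinuousOn (fun y => c y + ε * w y) (Metric.closedBall p ρ) :=
    hcb.add (continuous_const.mul hwC.continuous).continuousOn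
  obtain ⟨q, hq, hqmax⟩ := (isCompact_closedBall p ρ).exists_isMaxOn
    ⟨p, Metric.mem_closedBall_self hρ.le⟩ hu
  have hqp : c p ≤ c q + ε * w q := by
    simpa [hw, hφp] using hqmax (Metric.mem_closedBall_self hρ.le)
  have hqball : q ∈ Metric.ball p ρ := by
    rcases (Metric.mem_closedBall.mp hq).lt_or_eq with h | h
    · exact h
    · exact absurd (hsphere q h) hqp.not_gt
  have hqloc : IsLocalMax (fun y => c y + ε * w y) q :=
    hqmax.isLocalMax (mem_of_superset (Metric.isOpen_ball.mem_nhds hqball)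
      Metric.ball_subset_closedBall)
  obtain ⟨hqΩ, hLwq, -⟩ := hball hq
  have hcq : ContDiffAt ℝ 2 c q := hc.contDiffAt (hΩ.mem_nhds hqΩ)
  have h1 := hqloc.Lop_nonneg hD v (hcq.add (contDiffAt_const.mul hwC.contDiffAt))
    (hDpos q hqΩ) (hαnn q hqΩ) (hcp.trans hqp)
  rw [Lop_add_const_mul hD v α hcq hwC.contDiffAt] at h1
  linarith [hLc q hqΩ, mul_neg_of_pos_of_neg hε hLwq]

lemma pd_const_sub_norm_sub_sq {d : ℕ} (a : ℝ) (y x : EuclideanSpace ℝ (Fin d)) (i : Fin d) :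
    pd d (fun x => a - ‖x - y‖ ^ 2) i x = -2 * (x - y) i := by
  have h := (((hasFDerivAt_id x).sub_const y).norm_sq).const_sub a
  simp only [id] at h
  rw [pd, h.fderiv]
  simp [EuclideanSpace.inner_single_right]

/-- In an inner product space, a closed ball having `[y, p]` as a diameter meets the complement of
the open ball centred at `y` through `p` only at `p`. -/
lemma norm_sub_lt_of_norm_sub_midpoint_le {E : Type*} [NormedAddCommGroup E]
    [InnerProductSpace ℝ E] {x y p : E}
    (h : ‖x - midpoint ℝ y p‖ ≤ ‖p - midpoint ℝ y p‖) (hxp : x ≠ p) : ‖x - y‖ < ‖p - y‖ := by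
  set m := midpoint ℝ y p with hm
  have hb : p - m = m - y := by
    rw [hm, right_sub_midpoint, midpoint_sub_left]
  have h1 : x - y = (x - m) + (p - m) := by rw [hb]; abel
  have h2 : p - y = (2 : ℝ) • (p - m) := by rw [two_smul]; nth_rw 2 [hb]; abel
  have h3 : x - p = (x - m) - (p - m) := by abel
  have h4 := parallelogram_law_with_norm ℝ (x - m) (p - m)
  rw [← h1, ← h3] at h4
  have h5 : 0 < ‖x - p‖ := norm_pos_iff.mpr (sub_ne_zero.mpr hxp)
  have h6 : ‖p - y‖ = 2 * ‖p - m‖ := by rw [h2, norm_smul]; norm_num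
  rw [h6]
  nlinarith [norm_nonneg (x - m), norm_nonneg (p - m), norm_nonneg (x - y)]

lemma posSemidef_of_elliptic {d : ℕ} {A : Matrix (Fin d) (Fin d) ℝ} (hA : A.IsSymm) {l : ℝ}
    (hl : 0 ≤ l) (h : ∀ ξ : Fin d → ℝ, l * (∑ i, ξ i ^ 2) ≤ ∑ i, ∑ j, ξ i * A i j * ξ j) :
    A.PosSemidef := by
  refine Matrix.PosSemidef.of_dotProduct_mulVec_nonneg ?_ fun ξ => ?_
  · simpa [Matrix.IsHermitian, Matrix.conjTranspose_eq_transpose_of_trivial] using hA.eq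
  · refine (mul_nonneg hl (Finset.sum_nonneg fun i _ => sq_nonneg (ξ i))).trans ((h ξ).trans_eq ?_)
    simp [dotProduct, Matrix.mulVec, Finset.mul_sum, mul_assoc]

end

/-- Continuous strong maximum principle. -/
theorem continuous_strong_maximum_principle
    (d : ℕ) (hd : 1 ≤ d)
    (Ω : Set (EuclideanSpace ℝ (Fin d)))
    (hΩne : Ω.Nonempty) (hΩopen : IsOpen Ω) (hΩbd : Bornology.IsBounded Ω)
    (hΩconn : IsConnected Ω)
    (D : EuclideanSpace ℝ (Fin d) → Matrix (Fin d) (Fin d) ℝ)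
    (hD : ∀ i j, ContDiff ℝ 1 (fun x => D x i j))
    (hDsymm : ∀ x, (D x).IsSymm)
    (lam0 Lam : ℝ) (hlam0 : 0 < lam0) (hlamLam : lam0 ≤ Lam)
    (hellip : ∀ x ∈ Ω, ∀ ξ : Fin d → ℝ,
      lam0 * (∑ i, ξ i ^ 2) ≤ (∑ i, ∑ j, ξ i * D x i j * ξ j) ∧
      (∑ i, ∑ j, ξ i * D x i j * ξ j) ≤ Lam * (∑ i, ξ i ^ 2))
    (v : EuclideanSpace ℝ (Fin d) → EuclideanSpace ℝ (Fin d))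
    (hv : ContinuousOn v Ω) (hvbd : ∃ M, ∀ x ∈ Ω, ‖v x‖ ≤ M)
    (α : EuclideanSpace ℝ (Fin d) → ℝ)
    (hα : Continuous α) (hαnn : ∀ x ∈ Ω, 0 ≤ α x)
    (c : EuclideanSpace ℝ (Fin d) → ℝ)
    (hc : ContDiffOn ℝ 2 c Ω) (hccont : ContinuousOn c (closure Ω))
    (hLc : ∀ x ∈ Ω, Lop d D v α c x ≤ 0)
    (x₀ : EuclideanSpace ℝ (Fin d)) (hx₀ : x₀ ∈ Ω)
    (hmax : ∀ x ∈ closure Ω, c x ≤ c x₀) (hnn : 0 ≤ c x₀) :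
    ∀ x ∈ closure Ω, c x = c x₀ := by
  have hDpos : ∀ x ∈ Ω, (D x).PosSemidef := fun x hx =>
    posSemidef_of_elliptic (hDsymm x) hlam0.le fun ξ => (hellip x hx ξ).1
  have hcΩ : ContinuousOn c Ω := hc.continuousOn
  have hmaxΩ : ∀ x ∈ Ω, c x ≤ c x₀ := fun x hx => hmax x (subset_closure hx)
  have hopen : IsOpen (Ω ∩ c ⁻¹' {c x₀}) := by
    rw [Metric.isOpen_iff]
    rintro z ⟨hzΩ, hz : c z = c x₀⟩
    obtain ⟨R, hR, hRΩ⟩ := Metric.nhds_basis_closedBall.mem_iff.mp (hΩopen.mem_nhds hzΩ)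
    refine ⟨R / 2, by positivity, fun y hy => ?_⟩
    have hyz : dist y z < R / 2 := hy
    have hyΩ : y ∈ Ω := hRΩ (Metric.mem_closedBall.mpr (by linarith))
    refine ⟨hyΩ, ?_⟩
    by_contra hyc
    have hcpt : IsCompact (Metric.closedBall z R ∩ c ⁻¹' {c x₀}) :=
      (isCompact_closedBall z R).of_isClosed_subset
        ((hcΩ.mono hRΩ).preimage_isClosed_of_isClosed Metric.isClosed_closedBall
          isClosed_singleton) Set.inter_subset_left
    obtain ⟨p, ⟨hpR, hp : c p = c x₀⟩, hpmin⟩ := hcpt.exists_isMinOn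
      ⟨z, Metric.mem_closedBall_self hR.le, hz⟩
      (f := fun x => dist x y) (by fun_prop)
    have hpmin' : ∀ x ∈ Metric.closedBall z R, c x = c x₀ → dist p y ≤ dist x y :=
      fun x h1 h2 => hpmin ⟨h1, h2⟩
    have hpΩ : p ∈ Ω := hRΩ hpR
    have hpy : p ≠ y := fun h => hyc (h ▸ hp)
    have hpz : dist p y < R / 2 := by
      have := hpmin' z (Metric.mem_closedBall_self hR.le) hz
      rw [dist_comm z y] at this
      linarith
    set m := midpoint ℝ y p with hm
    have hpm : p - m ≠ 0 := by
      rw [sub_ne_zero, hm, ne_comm, Ne, midpoint_eq_right_iff]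
      exact hpy.symm
    refine false_of_lt_on_superlevel hΩopen hD hDpos hv hα hαnn hc hLc hpΩ (hp ▸ hnn)
      (hp ▸ hmaxΩ) (φ := fun x => ‖p - m‖ ^ 2 - ‖x - m‖ ^ 2)
      (contDiff_const.sub ((contDiff_id.sub contDiff_const).norm_sq ℝ)) (sub_self _) ?_ ?_
    · refine lt_of_lt_of_le (mul_pos hlam0 ?_) (hellip p hpΩ _).1
      simp only [pd_const_sub_norm_sub_sq, mul_pow, ← Finset.mul_sum]
      rw [← EuclideanSpace.real_norm_sq_eq]
      have := norm_pos_iff.mpr hpm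
      positivity
    · intro x hx hφx hxp
      have h1 : ‖x - m‖ ≤ ‖p - m‖ :=
        (sq_le_sq₀ (norm_nonneg _) (norm_nonneg _)).mp (sub_nonneg.mp hφx)
      have h2 := norm_sub_lt_of_norm_sub_midpoint_le h1 hxp
      rw [← dist_eq_norm, ← dist_eq_norm] at h2
      refine lt_of_le_of_ne (hp ▸ hmaxΩ x hx) fun h => ?_
      refine h2.not_ge (hpmin' x (Metric.mem_closedBall.mpr ?_) (h.trans hp))
      linarith [dist_triangle x y z]
  have hsub : Ω ⊆ Ω ∩ c ⁻¹' {c x₀} := by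
    refine hΩconn.isPreconnected.subset_left_of_subset_union hopen
      (hcΩ.isOpen_inter_preimage hΩopen
        (isClosed_singleton (x := c x₀)).isOpen_compl) ?_ ?_
      ⟨x₀, hx₀, hx₀, rfl⟩
    · exact Set.disjoint_left.mpr fun x h1 h2 => h2.2 h1.2
    · intro x hx
      by_cases h : c x = c x₀
      · exact Or.inl ⟨hx, h⟩
      · exact Or.inr ⟨hx, h⟩
  intro x hx
  exact Set.EqOn.of_subset_closure (f := c) (g := fun _ => c x₀) (fun y hy => (hsub hy).2) hccont
    continuousOn_const subset_closure subset_rfl hx
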